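/- Addition part of the Addition–Deletion theorem for multiarrangements: let (A, ν) be a multiarrangement, H_0 ∈ A, and (A', ν'), (A'', ν*) the deletion and restriction with respect to H_0. If (A', ν') is free with exponents {b_1, ..., b_{ℓ-1}, b_ℓ - 1} and (A'', ν*) is free with exponents {b_1, ..., b_{ℓ-1}}, then (A, ν) is free with exponents {b_1, ..., b_{ℓ-1}, b_ℓ}. -/

import Mathlib

open MvPolynomial

/-- The linear form `∑ αᵢ xᵢ` as a polynomial. -/
noncomputable def lin {K : Type} [Field K] {ℓ : ℕ} (α : Fin ℓ → K) :
    MvPolynomial (Fin ℓ) K :=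
  ∑ i, C (α i) * X i

/-- The value of the derivation `∑ fᵢ ∂/∂xᵢ` on the linear form `∑ αᵢ xᵢ`. -/
noncomputable def derAp {K : Type} [Field K] {ℓ : ℕ}
    (f : Fin ℓ → MvPolynomial (Fin ℓ) K) (α : Fin ℓ → K) : MvPolynomial (Fin ℓ) K :=
  ∑ i, C (α i) * f i

/-- Membership in `D(A,ν)` for the multiarrangement with hyperplanes `ker(α i)` of
multiplicity `ν i`. -/
def memD {K : Type} [Field K] {ℓ : ℕ} {I : Type} [Fintype I]
    (α : I → Fin ℓ → K) (ν : I → ℕ) (f : Fin ℓ → MvPolynomial (Fin ℓ) K) : Prop :=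
  ∀ i, lin (α i) ^ ν i ∣ derAp f (α i)

/-- `θ` is an `S`-basis of the set `D`. -/
def isBasisOf {K : Type} [Field K] {ℓ n : ℕ}
    (D : (Fin ℓ → MvPolynomial (Fin ℓ) K) → Prop)
    (θ : Fin n → Fin ℓ → MvPolynomial (Fin ℓ) K) : Prop :=
  (∀ j, D (θ j)) ∧
    ∀ g, D g → ∃! c : Fin n → MvPolynomial (Fin ℓ) K, g = ∑ j, c j • θ j

/-- The derivation `∑ f i ∂/∂x i` is homogeneous of polynomial degree `p`. -/
def homogOf {K : Type} [Field K] {ℓ : ℕ}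
    (f : Fin ℓ → MvPolynomial (Fin ℓ) K) (p : ℕ) : Prop :=
  ∀ i, f i = 0 ∨ (f i).IsHomogeneous p

/-- The Euler multiplicity of the point of the restriction whose localization consists of the
hyperplanes `ker (α i)`, `i ∈ loc` (a rank-2 localization containing `i₀`), is `e`: the
localized module has a homogeneous basis with a distinguished element `θ ∉ α_{i₀}·Der S` of
polynomial degree `e`, an element `ψ ∈ α_{i₀}·Der S`, and all remaining elements of degree 0. -/
def eulerDeg {K : Type} [Field K] {n : ℕ} {I : Type} [Fintype I]
    (α : I → Fin n → K) (ν : I → ℕ) (i₀ : I) (loc : Set I) (e : ℕ) : Prop :=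
  ∃ B : Fin n → Fin n → MvPolynomial (Fin n) K, ∃ d : Fin n → ℕ,
    isBasisOf (fun f => ∀ i ∈ loc, lin (α i) ^ ν i ∣ derAp f (α i)) B ∧
    (∀ k, homogOf (B k) (d k)) ∧
    ∃ k₀ k₁ : Fin n, k₀ ≠ k₁ ∧
      ¬ (∀ t, lin (α i₀) ∣ B k₀ t) ∧ d k₀ = e ∧
      (∀ t, lin (α i₀) ∣ B k₁ t) ∧
      (∀ k, k ≠ k₀ → k ≠ k₁ → d k = 0)

section basics
variable {K : Type} [Field K]

lemma lin_homog {n : ℕ} (a : Fin n → K) : (lin a).IsHomogeneous 1 := by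
  unfold lin
  exact IsHomogeneous.sum _ _ _ fun i _ => isHomogeneous_C_mul_X _ _

lemma lin_coeff {n : ℕ} (a : Fin n → K) (i : Fin n) :
    coeff (Finsupp.single i 1) (lin a) = a i := by
  classical
  unfold lin
  simp only [coeff_sum, coeff_C_mul, coeff_X]
  rw [Finset.sum_eq_single i]
  · simp
  · intro j _ hj
    rw [if_neg, mul_zero]
    intro h
    exact hj (Finsupp.single_left_injective one_ne_zero h)
  · simp

lemma lin_ne_zero {n : ℕ} {a : Fin n → K} (ha : a ≠ 0) : lin a ≠ 0 := by
  intro h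
  apply ha
  funext i
  rw [← lin_coeff a i, h]; simp

lemma lin_smul {n : ℕ} (c : K) (a : Fin n → K) : lin (c • a) = C c * lin a := by
  simp [lin, Finset.mul_sum, mul_assoc]

lemma lin_prime {n : ℕ} {a : Fin n → K} (ha : a ≠ 0) : Prime (lin a) := by
  rw [← UniqueFactorizationMonoid.irreducible_iff_prime]
  apply irreducible_of_totalDegree_eq_one
  · exact (lin_homog a).totalDegree (lin_ne_zero ha)
  · intro x hx
    rw [isUnit_iff_ne_zero]
    rintro rfl
    apply lin_ne_zero ha
    ext d
    simpa using hx d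

/-- A homogeneous polynomial of degree 0 is a constant. -/
lemma homog_zero_eq_C {n : ℕ} {f : MvPolynomial (Fin n) K} (hf : f.IsHomogeneous 0) :
    f = C (coeff 0 f) := by
  rw [← totalDegree_zero_iff_isHomogeneous] at hf
  exact (totalDegree_eq_zero_iff_eq_C).1 hf

lemma dvd_homog_eq {n m : ℕ} {f g : MvPolynomial (Fin n) K} (hf : f.IsHomogeneous m)
    (hg : g.IsHomogeneous m) (hg0 : g ≠ 0) (h : f ∣ g) : ∃ c : K, c ≠ 0 ∧ g = C c * f := by
  obtain ⟨q, rfl⟩ := h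
  have hf0 := left_ne_zero_of_mul hg0
  have hq0 := right_ne_zero_of_mul hg0
  have h1 := hg.totalDegree hg0
  rw [totalDegree_mul_of_isDomain hf0 hq0, hf.totalDegree hf0] at h1
  have h2 := (totalDegree_eq_zero_iff_eq_C).1 (show q.totalDegree = 0 by omega)
  refine ⟨coeff 0 q, ?_, ?_⟩
  · intro h0
    rw [h0] at h2
    exact hq0 (by simpa using h2)
  · rw [← h2, mul_comm]

lemma lin_dvd {n : ℕ} {a a' : Fin n → K} (ha' : a' ≠ 0) (h : lin a ∣ lin a') :
    ∃ c : K, a' = c • a := by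
  obtain ⟨c, -, hc⟩ := dvd_homog_eq (lin_homog a) (lin_homog a') (lin_ne_zero ha') h
  refine ⟨c, funext fun i => ?_⟩
  rw [← lin_coeff a' i, hc, coeff_C_mul, lin_coeff]; rfl

lemma lin_relPrime {n : ℕ} {a a' : Fin n → K} (ha : a ≠ 0) (ha' : a' ≠ 0)
    (h : ∀ c : K, a' ≠ c • a) (p q : ℕ) : IsRelPrime (lin a ^ p) (lin a' ^ q) := by
  apply IsRelPrime.pow
  exact ((lin_prime ha).irreducible.isRelPrime_iff_not_dvd).2
    fun hd => (lin_dvd ha' hd).elim fun c hc => h c hc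

lemma derAp_sum {n m : ℕ} (c : Fin m → MvPolynomial (Fin n) K)
    (B : Fin m → Fin n → MvPolynomial (Fin n) K) (a : Fin n → K) :
    derAp (∑ k, c k • B k) a = ∑ k, c k * derAp (B k) a := by
  simp only [derAp, Finset.sum_apply, Pi.smul_apply, smul_eq_mul, Finset.mul_sum]
  rw [Finset.sum_comm]
  exact Finset.sum_congr rfl fun _ _ => Finset.sum_congr rfl fun _ _ => by ring

lemma derAp_smul {n : ℕ} (c : MvPolynomial (Fin n) K)
    (f : Fin n → MvPolynomial (Fin n) K) (a : Fin n → K) :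
    derAp (c • f) a = c * derAp f a := by
  simp only [derAp, Pi.smul_apply, smul_eq_mul, Finset.mul_sum]
  exact Finset.sum_congr rfl fun _ _ => by ring

lemma derAp_homog {n p : ℕ} {f : Fin n → MvPolynomial (Fin n) K} (a : Fin n → K)
    (hf : ∀ i, (f i).IsHomogeneous p) : (derAp f a).IsHomogeneous p := by
  exact IsHomogeneous.sum _ _ _ fun i _ => (hf i).C_mul _

lemma homogOf_iff {n p : ℕ} {f : Fin n → MvPolynomial (Fin n) K} :
    homogOf f p ↔ ∀ i, (f i).IsHomogeneous p := by
  constructor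
  · intro h i
    rcases h i with h | h
    · rw [h]; exact isHomogeneous_zero _ _ _
    · exact h
  · exact fun h i => Or.inr (h i)

lemma comp_mul {n p d : ℕ} (c : MvPolynomial (Fin n) K) {f : MvPolynomial (Fin n) K}
    (hf : f.IsHomogeneous p) :
    homogeneousComponent d (c * f) =
      if p ≤ d then homogeneousComponent (d - p) c * f else 0 := by
  letI := MvPolynomial.gradedAlgebra (σ := Fin n) (R := K)
  have hf' : f ∈ homogeneousSubmodule (Fin n) K p := hf
  have key : ∀ (e : ℕ) (g : MvPolynomial (Fin n) K), (homogeneousComponent e g) =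
      (DirectSum.decompose (homogeneousSubmodule (Fin n) K) g e : MvPolynomial (Fin n) K) := by
    intro e g; rw [← decomposition.decompose'_apply]; rfl
  split_ifs with h
  · rw [key, key, DirectSum.coe_decompose_mul_of_right_mem_of_le _ hf' h]
  · rw [key, DirectSum.coe_decompose_mul_of_right_mem_of_not_le _ hf' h]

lemma det_homog {n m : ℕ} (M : Matrix (Fin m) (Fin m) (MvPolynomial (Fin n) K)) (d : Fin m → ℕ)
    (h : ∀ i j, (M i j).IsHomogeneous (d i)) : M.det.IsHomogeneous (∑ i, d i) := by
  rw [← Matrix.det_transpose, Matrix.det_apply]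
  refine IsHomogeneous.sum _ _ _ fun σ _ => ?_
  have : (∏ i, M.transpose (σ i) i).IsHomogeneous (∑ i, d i) :=
    IsHomogeneous.prod _ _ _ fun i _ => h _ _
  rcases Int.units_eq_one_or (Equiv.Perm.sign σ) with h | h <;> rw [h]
  · simpa using this
  · simpa using this.neg

/-- Change of coordinates matrix: replace coordinate `t` by the value on `a`. -/
lemma det_mul_lin {n : ℕ} (M : Matrix (Fin n) (Fin n) (MvPolynomial (Fin n) K))
    (a : Fin n → K) (t : Fin n) :
    (M.updateCol t (fun k => derAp (M k) a)).det = M.det * C (a t) := by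
  have h1 : ((1 : Matrix (Fin n) (Fin n) (MvPolynomial (Fin n) K)).updateCol t
      (fun i => C (a i))).det = C (a t) := by
    rw [← Matrix.cramer_apply, Matrix.cramer_one]; rfl
  rw [← h1, ← Matrix.det_mul]
  congr 1
  ext k s
  rw [Matrix.mul_apply]
  by_cases hs : s = t
  · subst hs
    simp [derAp, mul_comm]
  · simp [Matrix.updateCol_ne hs, Matrix.one_apply]

lemma exists_coord {n : ℕ} {a : Fin n → K} (ha : a ≠ 0) : ∃ t, a t ≠ 0 := by
  by_contra! h
  exact ha (funext h)

lemma C_unit {n : ℕ} {c : K} (hc : c ≠ 0) : IsUnit (C c : MvPolynomial (Fin n) K) :=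
  (isUnit_iff_ne_zero.2 hc).map C

lemma det_dvd {n : ℕ} (M : Matrix (Fin n) (Fin n) (MvPolynomial (Fin n) K))
    {a : Fin n → K} (ha : a ≠ 0) (p : MvPolynomial (Fin n) K) (h : ∀ k, p ∣ derAp (M k) a) :
    p ∣ M.det := by
  obtain ⟨t, ht⟩ := exists_coord ha
  have h1 := det_mul_lin M a t
  choose q hq using h
  have h2 : (fun k => derAp (M k) a) = p • q := funext hq
  rw [h2, Matrix.det_updateCol_smul] at h1
  exact (C_unit ht).dvd_mul_right.1 ⟨_, h1.symm⟩

end basics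
section saito
variable {K : Type} [Field K]

lemma det_dvd_det {n : ℕ} {D : (Fin n → MvPolynomial (Fin n) K) → Prop}
    {θ : Fin n → Fin n → MvPolynomial (Fin n) K} (hb : isBasisOf D θ)
    (N : Fin n → Fin n → MvPolynomial (Fin n) K) (hN : ∀ k, D (N k)) :
    (Matrix.of θ).det ∣ (Matrix.of N).det := by
  have h : ∀ k, ∃ c : Fin n → MvPolynomial (Fin n) K, N k = ∑ j, c j • θ j :=
    fun k => (hb.2 _ (hN k)).exists
  choose c hc using h
  have : Matrix.of N = Matrix.of c * Matrix.of θ := by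
    ext1 k s
    rw [Matrix.mul_apply, Matrix.of_apply, hc]
    simp
  rw [this, Matrix.det_mul]
  exact dvd_mul_left _ _

lemma derAp_single {n : ℕ} (s : Fin n) (p : MvPolynomial (Fin n) K) (a : Fin n → K) :
    derAp (Pi.single s p) a = C (a s) * p := by
  unfold derAp
  rw [Finset.sum_eq_single s]
  · simp
  · intro j _ hj; simp [hj]
  · simp

lemma derAp_sub {n : ℕ} (f g : Fin n → MvPolynomial (Fin n) K) (a : Fin n → K) :
    derAp (f - g) a = derAp f a - derAp g a := by
  simp [derAp, mul_sub]

lemma derAp_add {n : ℕ} (f g : Fin n → MvPolynomial (Fin n) K) (a : Fin n → K) :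
    derAp (f + g) a = derAp f a + derAp g a := by
  simp [derAp, mul_add, Finset.sum_add_distrib]

lemma prod_lin_ne {n : ℕ} {I : Type} (s : Finset I) (α : I → Fin n → K) (ν : I → ℕ)
    (hne : ∀ i, α i ≠ 0) : ∏ i ∈ s, lin (α i) ^ ν i ≠ 0 :=
  Finset.prod_ne_zero_iff.2 fun i _ => pow_ne_zero _ (lin_ne_zero (hne i))

lemma det_basis_ne {n : ℕ} {I : Type} [Fintype I] (α : I → Fin n → K) (ν : I → ℕ)
    (hne : ∀ i, α i ≠ 0) {θ : Fin n → Fin n → MvPolynomial (Fin n) K}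
    (hb : isBasisOf (memD α ν) θ) : (Matrix.of θ).det ≠ 0 := by
  classical
  intro h0
  have h1 := det_dvd_det hb (fun s => Pi.single s (∏ i, lin (α i) ^ ν i)) (fun k i => by
    rw [derAp_single]
    exact Dvd.dvd.mul_left (Finset.dvd_prod_of_mem _ (Finset.mem_univ i)) _)
  rw [h0, zero_dvd_iff] at h1
  have h2 : Matrix.of (fun s : Fin n => (Pi.single s (∏ i, lin (α i) ^ ν i) :
      Fin n → MvPolynomial (Fin n) K)) = Matrix.diagonal (fun _ => ∏ i, lin (α i) ^ ν i) := by
    ext1 a b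
    by_cases hab : a = b
    · subst hab; simp
    · simp [hab, Pi.single_apply, Ne.symm hab]
  rw [h2, Matrix.det_diagonal] at h1
  exact (Finset.prod_ne_zero_iff.2 fun _ _ => prod_lin_ne _ α ν hne) h1

lemma det_dvd_erase {n : ℕ} {I : Type} [Fintype I] [DecidableEq I] (α : I → Fin n → K)
    (ν : I → ℕ) (hne : ∀ i, α i ≠ 0) {θ : Fin n → Fin n → MvPolynomial (Fin n) K}
    (hb : isBasisOf (memD α ν) θ) (i : I) :
    (Matrix.of θ).det ∣
      (∏ k ∈ Finset.univ.erase i, lin (α k) ^ ν k) ^ n * lin (α i) ^ ν i := by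
  obtain ⟨t, ht⟩ := exists_coord (hne i)
  set R := ∏ k ∈ Finset.univ.erase i, lin (α k) ^ ν k with hR
  let N0 : Matrix (Fin n) (Fin n) (MvPolynomial (Fin n) K) := Matrix.of fun s =>
    if s = t then Pi.single t (lin (α i) ^ ν i) else
      Pi.single s (C (α i t)) - Pi.single t (C (α i s))
  have hval : ∀ s, derAp (N0 s) (α i) = if s = t then C (α i t) * lin (α i) ^ ν i else 0 := by
    intro s
    by_cases hs : s = t
    · have h0 : N0 s = Pi.single t (lin (α i) ^ ν i) := if_pos hs
      rw [h0, if_pos hs, derAp_single]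
    · have h0 : N0 s = Pi.single s (C (α i t)) - Pi.single t (C (α i s)) := if_neg hs
      rw [h0, if_neg hs, derAp_sub, derAp_single, derAp_single]
      ring
  have h1 := det_dvd_det hb (fun s => R • N0 s) (fun s k => by
    rw [derAp_smul]
    by_cases hk : k = i
    · subst hk
      rw [hval]
      split_ifs
      · exact Dvd.intro_left (R * C (α k t)) (by ring)
      · simp
    · exact Dvd.dvd.mul_right
        (Finset.dvd_prod_of_mem _ (Finset.mem_erase.2 ⟨hk, Finset.mem_univ _⟩)) _)
  have h2 : Matrix.of (fun s => R • N0 s) = R • N0 := rfl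
  rw [h2, Matrix.det_smul, Fintype.card_fin] at h1
  have h3 := det_mul_lin N0 (α i) t
  have h4 : N0.updateCol t (fun k => derAp (N0 k) (α i)) =
      Matrix.diagonal (fun s => C (α i t) * if s = t then lin (α i) ^ ν i else 1) := by
    ext1 a b
    by_cases hb : b = t
    · subst hb
      rw [Matrix.updateCol_self, hval]
      by_cases hab : a = b
      · subst hab; simp
      · simp [hab]
    · rw [Matrix.updateCol_ne hb]
      by_cases ha : a = t
      · subst ha
        simp [N0, Ne.symm hb, hb]
      · by_cases hab : a = b
        · subst hab; simp [N0, ha]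
        · simp [N0, ha, hab, hb, Ne.symm hab]
  rw [h4, Matrix.det_diagonal, Finset.prod_mul_distrib, Finset.prod_const,
    Finset.prod_ite_eq' ] at h3
  simp only [Finset.mem_univ, if_true] at h3
  have hu : IsUnit (C (α i t) : MvPolynomial (Fin n) K) := C_unit ht
  have h5 : N0.det ∣ lin (α i) ^ ν i := by
    rw [← (hu.pow (Finset.univ : Finset (Fin n)).card).dvd_mul_left, h3]
    exact dvd_mul_right _ _
  exact h1.trans (mul_dvd_mul_left _ h5)

lemma saito_le {n : ℕ} {I : Type} [Fintype I] [DecidableEq I] (i₀ : I) (α : I → Fin n → K)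
    (ν : I → ℕ) (hne : ∀ i, α i ≠ 0) (hprop : ∀ i j, i ≠ j → ∀ c : K, α i ≠ c • α j)
    {θ : Fin n → Fin n → MvPolynomial (Fin n) K}
    (hb : isBasisOf (memD α ν) θ) (d : Fin n → ℕ) (hd : ∀ k, homogOf (θ k) (d k)) :
    ∑ k, d k ≤ ∑ i, ν i := by
  have hQ : ∏ i, lin (α i) ^ ν i ∣ (Matrix.of θ).det := by
    apply Fintype.prod_dvd_of_isRelPrime
    · intro i j hij
      exact lin_relPrime (hne i) (hne j) (hprop j i hij.symm) _ _
    · intro i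
      exact det_dvd _ (hne i) _ fun k => hb.1 k i
  obtain ⟨f, hf⟩ := hQ
  have hdet := det_basis_ne α ν hne hb
  have hfR : ∀ i, f ∣ (∏ k ∈ Finset.univ.erase i, lin (α k) ^ ν k) ^ n := by
    intro i
    have h1 := det_dvd_erase α ν hne hb i
    rw [hf, ← Finset.mul_prod_erase _ _ (Finset.mem_univ i), mul_comm _ (lin (α i) ^ ν i),
      mul_assoc] at h1
    exact (dvd_mul_left _ _).trans
      ((mul_dvd_mul_iff_left (pow_ne_zero _ (lin_ne_zero (hne i)))).1 h1)
  have key : ∀ p, Prime p → ∀ i, p ∣ f → ∃ k, k ≠ i ∧ p ∣ lin (α k) := by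
    intro p hp i hpf
    have h1 := hp.dvd_of_dvd_pow (hpf.trans (hfR i))
    obtain ⟨k, hk, hpk⟩ := (hp.dvd_finsetProd_iff _).1 h1
    exact ⟨k, (Finset.mem_erase.1 hk).1, hp.dvd_of_dvd_pow hpk⟩
  have hf0 : f ≠ 0 := by
    rintro rfl
    exact hdet (by rw [hf, mul_zero])
  have hfu : IsUnit f := by
    by_contra hfu
    obtain ⟨p, hp, hpf⟩ := WfDvdMonoid.exists_irreducible_factor hfu hf0
    have hp' := UniqueFactorizationMonoid.irreducible_iff_prime.1 hp
    obtain ⟨k, -, hk⟩ := key p hp' i₀ hpf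
    obtain ⟨m, hmk, hm⟩ := key p hp' k hpf
    have h1 : Associated p (lin (α k)) := hp.associated_of_dvd (lin_prime (hne k)).irreducible hk
    obtain ⟨c, hc⟩ := lin_dvd (hne m) (h1.dvd_iff_dvd_left.1 hm)
    exact hprop m k hmk c hc
  have h1 : (Matrix.of θ).det.IsHomogeneous (∑ k, d k) :=
    det_homog _ _ fun i j => homogOf_iff.1 (hd i) j
  have h2 : (∏ i, lin (α i) ^ ν i).IsHomogeneous (∑ i, ν i) :=
    IsHomogeneous.prod _ _ _ fun i _ => by simpa using (lin_homog (α i)).pow (ν i)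
  have h3 : (Matrix.of θ).det.totalDegree = ∑ k, d k := h1.totalDegree hdet
  rw [← h3, hf, totalDegree_mul_of_isDomain (prod_lin_ne _ α ν hne) hf0,
    h2.totalDegree (prod_lin_ne _ α ν hne),
    (MvPolynomial.isUnit_iff_totalDegree_of_isReduced.mp hfu).2, add_zero]

end saito

section restr
variable {K : Type} [Field K]

/-- Restriction of polynomials to the hyperplane where the last coordinate vanishes. -/
noncomputable def resP (K : Type) [Field K] (ℓ : ℕ) :
    MvPolynomial (Fin (ℓ + 1)) K →ₐ[K] MvPolynomial (Fin ℓ) K :=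
  aeval (Fin.snoc (α := fun _ => MvPolynomial (Fin ℓ) K) X 0)

/-- Extension of polynomials from the hyperplane. -/
noncomputable def liftP (K : Type) [Field K] (ℓ : ℕ) :
    MvPolynomial (Fin ℓ) K →ₐ[K] MvPolynomial (Fin (ℓ + 1)) K :=
  rename Fin.castSucc

variable {ℓ : ℕ}

lemma resP_X_last : resP K ℓ (X (Fin.last ℓ)) = 0 := by simp [resP]

lemma resP_X_castSucc (i : Fin ℓ) : resP K ℓ (X i.castSucc) = X i := by simp [resP]

lemma resP_C (c : K) : resP K ℓ (C c) = C c := by simp [resP]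

lemma resP_liftP (f : MvPolynomial (Fin ℓ) K) : resP K ℓ (liftP K ℓ f) = f := by
  have : (resP K ℓ).comp (liftP K ℓ) = AlgHom.id K _ := by
    apply MvPolynomial.algHom_ext
    intro i
    simp [liftP, resP_X_castSucc]
  exact DFunLike.congr_fun this f

lemma dvd_sub_liftP (f : MvPolynomial (Fin (ℓ + 1)) K) :
    X (Fin.last ℓ) ∣ f - liftP K ℓ (resP K ℓ f) := by
  induction f using MvPolynomial.induction_on with
  | C a => simp [resP_C, liftP]
  | add p q hp hq =>
    rw [map_add, map_add, add_sub_add_comm]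
    exact dvd_add hp hq
  | mul_X p i hp =>
    refine Fin.lastCases ?_ (fun i => ?_) i
    · simp [resP_X_last]
    · have : liftP K ℓ (X i) = X i.castSucc := by simp [liftP]
      rw [map_mul, resP_X_castSucc, map_mul, this, ← sub_mul]
      exact hp.mul_right _

lemma resP_eq_zero {f : MvPolynomial (Fin (ℓ + 1)) K} :
    resP K ℓ f = 0 ↔ X (Fin.last ℓ) ∣ f := by
  constructor
  · intro h
    simpa [h] using dvd_sub_liftP f
  · rintro ⟨q, rfl⟩
    rw [map_mul, resP_X_last, zero_mul]

lemma resP_lin (a : Fin (ℓ + 1) → K) : resP K ℓ (lin a) = lin (a ∘ Fin.castSucc) := by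
  simp [lin, Fin.sum_univ_castSucc, resP_X_last, resP_X_castSucc, resP_C]

lemma resP_derAp (f : Fin (ℓ + 1) → MvPolynomial (Fin (ℓ + 1)) K) (a : Fin ℓ → K) :
    resP K ℓ (derAp f (Fin.snoc (α := fun _ => K) a 0)) =
      derAp (fun t => resP K ℓ (f t.castSucc)) a := by
  simp [derAp, Fin.sum_univ_castSucc, resP_C]

lemma resP_homog {p : ℕ} {f : MvPolynomial (Fin (ℓ + 1)) K} (hf : f.IsHomogeneous p) :
    (resP K ℓ f).IsHomogeneous p := by
  have := hf.aeval (Fin.snoc (α := fun _ => MvPolynomial (Fin ℓ) K) X 0) (n := 1) (by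
    intro i
    refine Fin.lastCases ?_ (fun i => ?_) i
    · simpa using isHomogeneous_zero _ _ _
    · simpa using isHomogeneous_X _ _)
  simpa [resP] using this

lemma lin_last : lin (Pi.single (Fin.last ℓ) 1 : Fin (ℓ + 1) → K) = X (Fin.last ℓ) := by
  simp [lin, Fin.sum_univ_castSucc]

lemma derAp_last (f : Fin (ℓ + 1) → MvPolynomial (Fin (ℓ + 1)) K) :
    derAp f (Pi.single (Fin.last ℓ) 1 : Fin (ℓ + 1) → K) = f (Fin.last ℓ) := by
  simp [derAp, Fin.sum_univ_castSucc]

/-- Decomposition of the value on a form. -/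
lemma derAp_decomp (f : Fin (ℓ + 1) → MvPolynomial (Fin (ℓ + 1)) K) (a : Fin (ℓ + 1) → K)
    (c : K) (b : Fin ℓ → K) (h : a ∘ Fin.castSucc = c • b) :
    derAp f a = C c * derAp f (Fin.snoc (α := fun _ => K) b 0) +
      C (a (Fin.last ℓ)) * f (Fin.last ℓ) := by
  have h' : ∀ i : Fin ℓ, a i.castSucc = c * b i := fun i => congrFun h i
  simp [derAp, Fin.sum_univ_castSucc, h', Finset.mul_sum, mul_assoc]

end restr
section localpart
variable {K : Type} [Field K] {ℓ : ℕ}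

lemma homog_zero_dvd {n : ℕ} {f : MvPolynomial (Fin n) K} (hf : f.IsHomogeneous 0)
    {a : Fin n → K} (ha : a ≠ 0) (h : lin a ∣ f) : f = 0 := by
  have h1 := homog_zero_eq_C hf
  by_cases hc : coeff 0 f = 0
  · rw [h1, hc, C_0]
  · rw [h1] at h
    exact absurd (isUnit_of_dvd_unit h (C_unit hc)) (lin_prime ha).not_isUnit

lemma resP_prod {I : Type} (cls : Finset I) (α : I → Fin (ℓ + 1) → K) (ν : I → ℕ)
    (β : Fin ℓ → K) (hr : ∀ i ∈ cls, ∃ c : K, c ≠ 0 ∧ α i ∘ Fin.castSucc = c • β) :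
    Associated (resP K ℓ (∏ i ∈ cls, lin (α i) ^ ν i)) (lin β ^ ∑ i ∈ cls, ν i) := by
  rw [map_prod, ← Finset.prod_pow_eq_pow_sum]
  refine Associated.prod _ _ _ fun i hi => ?_
  obtain ⟨c, hc, h⟩ := hr i hi
  rw [map_pow, resP_lin, h, lin_smul]
  exact Associated.pow_pow (associated_unit_mul_left _ _ (C_unit hc))

lemma coeff_zero_of_homog {n e : ℕ} {f : MvPolynomial (Fin n) K} (hf : f.IsHomogeneous e)
    (he : e ≠ 0) : constantCoeff f = 0 := by
  rw [constantCoeff_eq]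
  exact hf.coeff_eq_zero (by simpa using he.symm)

/-- If no other hyperplane of the localization is active, the Euler multiplicity is zero. -/
lemma euler_zero {I : Type} (α : I → Fin (ℓ + 1) → K) (ν : I → ℕ) (i₀ : I)
    (hα₀ : α i₀ = Pi.single (Fin.last ℓ) 1) (loc : Set I)
    (hloc : ∀ i ∈ loc, i ≠ i₀ → ν i = 0)
    (B : Fin (ℓ + 1) → Fin (ℓ + 1) → MvPolynomial (Fin (ℓ + 1)) K) (d : Fin (ℓ + 1) → ℕ)
    (hB : isBasisOf (fun f => ∀ i ∈ loc, lin (α i) ^ ν i ∣ derAp f (α i)) B)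
    (hd : ∀ k, homogOf (B k) (d k)) (k₀ k₁ : Fin (ℓ + 1)) (hk : k₀ ≠ k₁)
    (hk₁ : ∀ t, lin (α i₀) ∣ B k₁ t) : d k₀ = 0 := by
  classical
  by_contra he
  let v : Fin (ℓ + 1) → Fin ℓ → K := fun k s => constantCoeff (B k s.castSucc)
  have hv0 : v k₀ = 0 := funext fun s => coeff_zero_of_homog (homogOf_iff.1 (hd k₀) _) he
  have hv1 : v k₁ = 0 := funext fun s => by
    obtain ⟨q, hq⟩ := hk₁ s.castSucc
    simp only [v]
    rw [hq, hα₀, lin_last]; simp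
  let s : Finset (Fin (ℓ + 1)) := (Finset.univ.erase k₀).erase k₁
  have hs : s.card + 1 = ℓ := by
    have h1 : (Finset.univ.erase k₀).card = ℓ := by simp
    have h2 := Finset.card_erase_add_one
      (show k₁ ∈ Finset.univ.erase k₀ from Finset.mem_erase.2 ⟨hk.symm, Finset.mem_univ _⟩)
    rw [h1] at h2
    exact h2
  have htop : Submodule.span K ((s.image v : Finset (Fin ℓ → K)) : Set (Fin ℓ → K)) = ⊤ := by
    rw [eq_top_iff, ← (Pi.basisFun K (Fin ℓ)).span_eq, Submodule.span_le]
    rintro _ ⟨t, rfl⟩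
    have hmem : ∀ i ∈ loc, lin (α i) ^ ν i ∣
        derAp (Pi.single t.castSucc (1 : MvPolynomial (Fin (ℓ + 1)) K)) (α i) := by
      intro i hi
      by_cases hii : i = i₀
      · subst hii
        rw [hα₀, derAp_last]
        simp [Pi.single_apply]
      · rw [hloc i hi hii, pow_zero]; exact one_dvd _
    obtain ⟨c, hc⟩ := (hB.2 _ hmem).exists
    have h1 : (Pi.basisFun K (Fin ℓ)) t = ∑ k, constantCoeff (c k) • v k := by
      funext r
      have h2 := congrArg constantCoeff (congrFun hc r.castSucc)
      simp only [Finset.sum_apply, Pi.smul_apply, smul_eq_mul, map_sum, map_mul] at h2 ⊢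
      rw [← h2]
      simp [Pi.single_apply]

    rw [h1]
    refine Submodule.sum_mem _ fun k _ => Submodule.smul_mem _ _ ?_
    by_cases h0 : k = k₀
    · rw [h0, hv0]; exact Submodule.zero_mem _
    by_cases h1 : k = k₁
    · rw [h1, hv1]; exact Submodule.zero_mem _
    apply Submodule.subset_span
    rw [Finset.mem_coe]
    exact Finset.mem_image_of_mem _ (by simp [s, h0, h1])
  have h3 := finrank_span_finset_le_card (R := K) (s.image v)
  rw [Set.finrank, htop, finrank_top, Module.finrank_fin_fun] at h3
  have h4 := Finset.card_image_le (s := s) (f := v)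
  omega

lemma local_key {I : Type} [Fintype I] (α : I → Fin (ℓ + 1) → K) (ν : I → ℕ) (i₀ : I)
    (hα₀ : α i₀ = Pi.single (Fin.last ℓ) 1) (hν₀ : 1 ≤ ν i₀)
    (hne : ∀ i, α i ≠ 0)
    (hprop : ∀ i j, i ≠ j → ∀ c : K, α i ≠ c • α j)
    (β : Fin ℓ → K) (hβ : β ≠ 0) (cls : Finset I) (hcls : i₀ ∉ cls)
    (hr : ∀ i ∈ cls, ∃ c : K, c ≠ 0 ∧ α i ∘ Fin.castSucc = c • β) (loc : Set I)
    (hloc : ∀ i, i ∈ loc ↔ i = i₀ ∨ i ∈ cls) (e : ℕ) (he : eulerDeg α ν i₀ loc e) :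
    (∀ f, (∀ i ∈ loc, lin (α i) ^ ν i ∣ derAp f (α i)) →
      lin β ^ e ∣ derAp (fun t => resP K ℓ (f t.castSucc)) β) ∧
    (∀ f q, (∀ i ∈ cls, lin (α i) ^ ν i ∣ derAp f (α i)) →
      f (Fin.last ℓ) = X (Fin.last ℓ) ^ (ν i₀ - 1) * q →
      lin β ^ (∑ i ∈ cls, ν i) ∣ resP K ℓ q * lin β ^ e) := by
  classical
  obtain ⟨B, d, hB, hd, k₀, k₁, hk, -, hdk, hk₁, hoth⟩ := he
  by_cases hA : ∀ i ∈ cls, ν i = 0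
  · have h0 := euler_zero α ν i₀ hα₀ loc
      (fun i hi hii => hA i (((hloc i).1 hi).resolve_left hii)) B d hB hd k₀ k₁ hk hk₁
    rw [hdk] at h0
    rw [h0, Finset.sum_eq_zero hA]
    simp
  push Not at hA
  obtain ⟨i₁, hi₁, hνi₁⟩ := hA
  set z : MvPolynomial (Fin (ℓ + 1)) K := X (Fin.last ℓ) with hz
  have hz0 : z ≠ 0 := X_ne_zero _
  have hlin : lin (α i₀) = z := by rw [hα₀, lin_last]
  set bt : Fin (ℓ + 1) → K := Fin.snoc (α := fun _ => K) β 0 with hbt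
  have hi₀ : i₀ ∈ loc := (hloc _).2 (Or.inl rfl)
  have hBlast : ∀ k, ∃ u, B k (Fin.last ℓ) = z ^ ν i₀ * u := by
    intro k
    have := hB.1 k i₀ hi₀
    rwa [hlin, hα₀, derAp_last] at this
  choose u hu using hBlast
  have hu0 : ∀ k, k ≠ k₀ → k ≠ k₁ → u k = 0 := by
    intro k h0 h1
    have h2 : B k (Fin.last ℓ) = 0 := by
      apply homog_zero_dvd (a := α i₀) _ (hne i₀)
      · rw [hlin, hu k]
        exact (dvd_pow_self z (by omega)).mul_right _
      · have := homogOf_iff.1 (hd k) (Fin.last ℓ)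
        rwa [hoth k h0 h1] at this
    rw [hu k] at h2
    exact (mul_eq_zero.1 h2).resolve_left (pow_ne_zero _ hz0)
  have hG0 : ∀ k, k ≠ k₀ → k ≠ k₁ → derAp (B k) bt = 0 := by
    intro k h0 h1
    have h2 : derAp (B k) (α i₁) = 0 := by
      apply homog_zero_dvd (a := α i₁) _ (hne i₁)
      · exact (dvd_pow_self _ hνi₁).trans (hB.1 k i₁ ((hloc _).2 (Or.inr hi₁)))
      · have := derAp_homog (α i₁) (homogOf_iff.1 (hd k))
        rwa [hoth k h0 h1] at this
    obtain ⟨c, hc, hcβ⟩ := hr i₁ hi₁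
    rw [derAp_decomp _ _ c β hcβ, hu k, hu0 k h0 h1, mul_zero, mul_zero, add_zero] at h2
    exact (mul_eq_zero.1 h2).resolve_left (C_unit hc).ne_zero
  obtain ⟨w, hw⟩ : z ∣ derAp (B k₁) bt := by
    refine Finset.dvd_sum fun t _ => ?_
    rw [← hlin]
    exact (hk₁ t).mul_left _
  have expand : ∀ c : Fin (ℓ + 1) → MvPolynomial (Fin (ℓ + 1)) K,
      (∑ k, c k • B k) (Fin.last ℓ) = z ^ ν i₀ * (c k₀ * u k₀ + c k₁ * u k₁) ∧
      derAp (∑ k, c k • B k) bt = c k₀ * derAp (B k₀) bt + z * (c k₁ * w) := by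
    intro c
    constructor
    · simp only [Finset.sum_apply, Pi.smul_apply, smul_eq_mul]
      rw [Fintype.sum_eq_add k₀ k₁ hk]
      · rw [hu k₀, hu k₁]; ring
      · rintro k ⟨h0, h1⟩
        rw [hu k, hu0 k h0 h1]; simp
    · rw [derAp_sum, Fintype.sum_eq_add k₀ k₁ hk]
      · rw [hw]; ring
      · rintro k ⟨h0, h1⟩
        rw [hG0 k h0 h1, mul_zero]
  set g := resP K ℓ (derAp (B k₀) bt) with hg
  have hresz : resP K ℓ z = 0 := resP_X_last
  set a := ∑ i ∈ cls, ν i with ha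
  set Q := ∏ i ∈ cls, lin (α i) ^ ν i with hQ
  have hQa : Associated (resP K ℓ Q) (lin β ^ a) := resP_prod cls α ν β hr
  have hgdvd : g ∣ lin β ^ a := by
    obtain ⟨t, ht⟩ := exists_coord hβ
    have hmem : ∀ i ∈ loc, lin (α i) ^ ν i ∣ derAp (Pi.single t.castSucc Q) (α i) := by
      intro i hi
      rcases (hloc i).1 hi with rfl | hi
      · rw [hα₀, derAp_last]
        simp [Pi.single_apply]
      · rw [derAp_single]
        exact (Finset.dvd_prod_of_mem (fun i => lin (α i) ^ ν i) hi).mul_left _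
    obtain ⟨c, hc⟩ := (hB.2 _ hmem).exists
    have h1 := (expand c).2
    rw [← hc, derAp_single] at h1
    have h2 := congrArg (resP K ℓ) h1
    rw [map_mul, map_add, map_mul, map_mul, hresz, zero_mul, add_zero, resP_C] at h2
    have h3 : bt t.castSucc = β t := by simp [hbt]
    rw [h3] at h2
    rw [← hQa.dvd_iff_dvd_right, ← (C_unit ht).dvd_mul_left, h2]
    exact dvd_mul_left _ _
  have hghom : g.IsHomogeneous e := by
    rw [← hdk]
    exact resP_homog (derAp_homog _ (homogOf_iff.1 (hd k₀)))
  have hg0 : g ≠ 0 := by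
    intro h
    rw [h, zero_dvd_iff] at hgdvd
    exact pow_ne_zero _ (lin_ne_zero hβ) hgdvd
  have hgass : Associated g (lin β ^ e) := by
    obtain ⟨m, -, hm⟩ := (dvd_prime_pow (lin_prime hβ) a).1 hgdvd
    obtain ⟨y, hy⟩ := hm
    have h1 : (lin β ^ m).totalDegree = m := by
      have := (lin_homog β).pow m
      rw [one_mul] at this
      exact this.totalDegree (pow_ne_zero _ (lin_ne_zero hβ))
    rw [← hy, totalDegree_mul_of_isDomain hg0 y.isUnit.ne_zero, hghom.totalDegree hg0,
      (MvPolynomial.isUnit_iff_totalDegree_of_isReduced.mp y.isUnit).2, add_zero] at h1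
    subst h1
    exact ⟨y, hy⟩
  constructor
  · intro f hf
    obtain ⟨c, hc⟩ := (hB.2 _ hf).exists
    have h1 := congrArg (resP K ℓ) (expand c).2
    rw [← hc, map_add, map_mul, map_mul, hresz, zero_mul, add_zero, resP_derAp] at h1
    rw [h1]
    exact hgass.symm.dvd.mul_left _
  · intro f q hf hq
    have hmem : ∀ i ∈ loc, lin (α i) ^ ν i ∣ derAp (z • f) (α i) := by
      intro i hi
      rw [derAp_smul]
      rcases (hloc i).1 hi with rfl | hi
      · rw [hlin, hα₀, derAp_last, hq, ← mul_assoc, ← pow_succ', Nat.sub_add_cancel hν₀]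
        exact dvd_mul_right _ _
      · exact (hf i hi).mul_left _
    obtain ⟨c, hc⟩ := (hB.2 _ hmem).exists
    obtain ⟨h1, h2⟩ := expand c
    rw [← hc] at h1 h2
    rw [Pi.smul_apply, smul_eq_mul, hq, ← mul_assoc, ← pow_succ', Nat.sub_add_cancel hν₀] at h1
    have h1' := mul_left_cancel₀ (pow_ne_zero _ hz0) h1
    rw [derAp_smul] at h2
    have h2' := congrArg (resP K ℓ) h2
    rw [map_mul, map_add, map_mul, map_mul, hresz, zero_mul, zero_mul, add_zero] at h2'
    have h3 : resP K ℓ (c k₀) = 0 := (mul_eq_zero.1 h2'.symm).resolve_right hg0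
    have h4 : Q ∣ u k₁ * derAp (B k₀) bt - u k₀ * (z * w) := by
      apply Finset.prod_dvd_of_isRelPrime
      · intro i _ j _ hij
        exact lin_relPrime (hne i) (hne j) (hprop j i hij.symm) _ _
      · intro i hi
        obtain ⟨x, hx, hxβ⟩ := hr i hi
        have hii : i ≠ i₀ := fun h => hcls (h ▸ hi)
        have hiloc : i ∈ loc := (hloc i).2 (Or.inr hi)
        have h5 : lin (α i) ^ ν i ∣
            u k₁ * derAp (B k₀) (α i) - u k₀ * derAp (B k₁) (α i) :=
          dvd_sub ((hB.1 k₀ i hiloc).mul_left _) ((hB.1 k₁ i hiloc).mul_left _)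
        rw [derAp_decomp _ _ x β hxβ, derAp_decomp (B k₁) _ x β hxβ, hu k₀, hu k₁, hw] at h5
        rw [← (C_unit hx).dvd_mul_left]
        convert h5 using 1
        ring
    have h6 := map_dvd (resP K ℓ) h4
    rw [map_sub, map_mul, map_mul, map_mul, hresz, zero_mul, mul_zero, sub_zero,
      hQa.dvd_iff_dvd_left] at h6
    have h7 := h6.trans (mul_dvd_mul_left (resP K ℓ (u k₁)) hgass.dvd)
    rw [h1', map_add, map_mul, map_mul, h3, zero_mul, zero_add, mul_assoc]
    exact h7.mul_left _

end localpart
section globalpart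
variable {K : Type} [Field K] {ℓ : ℕ}

lemma homog_of_mul {n p m : ℕ} {c f : MvPolynomial (Fin n) K} (hf : f.IsHomogeneous m)
    (hcf : (c * f).IsHomogeneous p) (h0 : c * f ≠ 0) : m ≤ p ∧ c.IsHomogeneous (p - m) := by
  have h1 : homogeneousComponent p (c * f) = c * f := homogeneousComponent_eq_self hcf
  rw [comp_mul c hf] at h1
  split_ifs at h1 with h
  · refine ⟨h, ?_⟩
    have h2 := mul_right_cancel₀ (right_ne_zero_of_mul h0) h1
    rw [← h2]
    exact homogeneousComponent_isHomogeneous _ _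
  · exact absurd h1.symm h0

lemma coef_vanish {n m p : ℕ} {D : (Fin n → MvPolynomial (Fin n) K) → Prop}
    {η : Fin m → Fin n → MvPolynomial (Fin n) K} (hη : isBasisOf D η) (b : Fin m → ℕ)
    (hb : ∀ k, homogOf (η k) (b k)) (g : Fin n → MvPolynomial (Fin n) K) (hg : D g)
    (hgp : homogOf g p) :
    ∃ c : Fin m → MvPolynomial (Fin n) K, g = ∑ j, c j • η j ∧ ∀ j, p < b j → c j = 0 := by
  obtain ⟨c, hc⟩ := (hη.2 g hg).exists
  refine ⟨fun j => if b j ≤ p then homogeneousComponent (p - b j) (c j) else 0, ?_, ?_⟩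
  · funext t
    have h1 := congrArg (homogeneousComponent p) (congrFun hc t)
    rw [homogeneousComponent_eq_self (homogOf_iff.1 hgp t)] at h1
    rw [h1]
    simp only [Finset.sum_apply, Pi.smul_apply, smul_eq_mul, map_sum]
    refine Finset.sum_congr rfl fun j _ => ?_
    rw [comp_mul _ (homogOf_iff.1 (hb j) t)]
    split_ifs <;> simp
  · intro j hj
    exact if_neg (by omega)

lemma memD_sum {n m : ℕ} {I : Type} [Fintype I] (α : I → Fin n → K) (ν : I → ℕ)
    (c : Fin m → MvPolynomial (Fin n) K) (θ : Fin m → Fin n → MvPolynomial (Fin n) K)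
    (h : ∀ k, c k = 0 ∨ memD α ν (θ k)) : memD α ν (∑ k, c k • θ k) := by
  intro i
  rw [derAp_sum]
  refine Finset.dvd_sum fun k _ => ?_
  rcases h k with h | h
  · rw [h, zero_mul]; exact dvd_zero _
  · exact (h i).mul_left _

lemma memD_mono {n : ℕ} {I : Type} [Fintype I] (α : I → Fin n → K) {ν ν' : I → ℕ}
    (h : ∀ i, ν' i ≤ ν i) {f : Fin n → MvPolynomial (Fin n) K} (hf : memD α ν f) :
    memD α ν' f := fun i => (pow_dvd_pow _ (h i)).trans (hf i)

/-- Some basis element of low degree is not in the smaller module. -/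
lemma exists_low {I : Type} [Fintype I] [DecidableEq I]
    (α : I → Fin (ℓ + 1) → K) (ν : I → ℕ) (i₀ : I)
    (hα₀ : α i₀ = Pi.single (Fin.last ℓ) 1) (hν₀ : 1 ≤ ν i₀)
    (hne : ∀ i, α i ≠ 0)
    (hprop : ∀ i j, i ≠ j → ∀ c : K, α i ≠ c • α j)
    (D'' : (Fin ℓ → MvPolynomial (Fin ℓ) K) → Prop)
    (hρ : ∀ f, memD α ν f → D'' (fun t => resP K ℓ (f t.castSucc)))
    (b : Fin ℓ → ℕ) (bl : ℕ)
    (θ : Fin (ℓ + 1) → Fin (ℓ + 1) → MvPolynomial (Fin (ℓ + 1)) K)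
    (hθ : isBasisOf (memD α (Function.update ν i₀ (ν i₀ - 1))) θ)
    (hd : ∀ k, homogOf (θ k) ((Fin.snoc b bl : Fin (ℓ + 1) → ℕ) k))
    (η : Fin ℓ → Fin ℓ → MvPolynomial (Fin ℓ) K)
    (hη : isBasisOf D'' η) (hb : ∀ k, homogOf (η k) (b k)) :
    ∃ k, (Fin.snoc b bl : Fin (ℓ + 1) → ℕ) k ≤ bl ∧ ¬ memD α ν (θ k) := by
  classical
  set d : Fin (ℓ + 1) → ℕ := Fin.snoc b bl with hdd
  by_contra! hcon
  have hw : ∀ k, ∃ w : Fin ℓ → MvPolynomial (Fin ℓ) K,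
      (d k ≤ bl → (fun t => resP K ℓ (θ k (Fin.castSucc t))) = ∑ j, w j • η j ∧
        ∀ j, bl < b j → w j = 0) ∧
      (bl < d k → ∃ j, k = Fin.castSucc j ∧ w = Pi.single j 1) := by
    intro k
    by_cases hk : d k ≤ bl
    · obtain ⟨c, hc, hc'⟩ := coef_vanish hη b hb _ (hρ _ (hcon k hk)) (p := d k)
        (homogOf_iff.2 fun t => resP_homog (homogOf_iff.1 (hd k) _))
      exact ⟨c, fun _ => ⟨hc, fun j hj => hc' j (by omega)⟩, fun h => by omega⟩
    · revert hk
      refine Fin.lastCases ?_ (fun j => ?_) k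
      · intro h
        simp [hdd] at h
      · intro h
        exact ⟨Pi.single j 1, fun h' => absurd h' h, fun _ => ⟨j, rfl, rfl⟩⟩
  choose w hw1 hw2 using hw
  have hdep : ¬ LinearIndependent (MvPolynomial (Fin ℓ) K) w := by
    intro h
    have := h.fintype_card_le_finrank
    simp at this
  obtain ⟨x, hx, k', hk'⟩ := Fintype.not_linearIndependent_iff.1 hdep
  have hxbig : ∀ k, bl < d k → x k = 0 := by
    intro k hk
    obtain ⟨j, hj, hwj⟩ := hw2 k hk
    have hbj : bl < b j := by
      rw [hj] at hk
      simpa [hdd] using hk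
    have h1 := congrFun hx j
    rw [Finset.sum_apply, Finset.sum_eq_single k] at h1
    · simpa [hwj] using h1
    · intro k2 _ hne2
      by_cases h2 : d k2 ≤ bl
      · simp [(hw1 k2 h2).2 j hbj]
      · obtain ⟨j2, hj2, hwj2⟩ := hw2 k2 (by omega)
        have : j ≠ j2 := fun h => hne2 (by rw [hj2, hj, h])
        simp [hwj2, this]
    · simp
  set F := ∑ k, liftP K ℓ (x k) • θ k with hF
  have hFD : memD α ν F := by
    apply memD_sum
    intro k
    by_cases h : d k ≤ bl
    · exact Or.inr (hcon k h)
    · left; rw [hxbig k (by omega), map_zero]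
  have hFz : ∀ t, X (Fin.last ℓ) ∣ F t := by
    intro t
    refine Fin.lastCases ?_ (fun t => ?_) t
    · have h1 := hFD i₀
      rw [hα₀, derAp_last, lin_last] at h1
      exact (dvd_pow_self _ (by omega)).trans h1
    · rw [← resP_eq_zero, hF]
      simp only [Finset.sum_apply, Pi.smul_apply, smul_eq_mul, map_sum, map_mul, resP_liftP]
      have h2 : ∀ k, x k * resP K ℓ (θ k t.castSucc) = ∑ j, (x k * w k j) * η j t := by
        intro k
        by_cases h : d k ≤ bl
        · have h3 := congrFun (hw1 k h).1 t
          simp only [Finset.sum_apply, Pi.smul_apply, smul_eq_mul] at h3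
          rw [h3, Finset.mul_sum]
          exact Finset.sum_congr rfl fun _ _ => by ring
        · simp [hxbig k (by omega)]
      simp only [h2]
      rw [Finset.sum_comm]
      refine Finset.sum_eq_zero fun j _ => ?_
      rw [← Finset.sum_mul]
      have h4 := congrFun hx j
      simp only [Finset.sum_apply, Pi.smul_apply, smul_eq_mul, Pi.zero_apply] at h4
      rw [h4, zero_mul]
  choose φ hφ using hFz
  have hFφ : F = (X (Fin.last ℓ) : MvPolynomial (Fin (ℓ + 1)) K) • φ := funext hφ
  have hφD : memD α (Function.update ν i₀ (ν i₀ - 1)) φ := by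
    intro i
    have h1 := hFD i
    rw [hFφ, derAp_smul] at h1
    by_cases hi : i = i₀
    · subst hi
      rw [Function.update_self]
      rw [hα₀, lin_last] at h1 ⊢
      have h2 : ν i = ν i - 1 + 1 := by omega
      rw [h2, pow_succ'] at h1
      exact (mul_dvd_mul_iff_left (X_ne_zero _)).1 h1
    · rw [Function.update_of_ne hi]
      have h3 : IsRelPrime (lin (α i) ^ ν i) (lin (α i₀) ^ 1) :=
        lin_relPrime (hne i) (hne i₀) (hprop i₀ i (Ne.symm hi)) _ _
      rw [pow_one, hα₀, lin_last] at h3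
      exact h3.dvd_of_dvd_mul_left h1
  obtain ⟨e, he⟩ := (hθ.2 _ hφD).exists
  have hF' : memD α (Function.update ν i₀ (ν i₀ - 1)) F := by
    apply memD_mono α _ hFD
    intro i
    by_cases hi : i = i₀
    · subst hi; simp
    · simp [hi]
  have h5 : F = ∑ k, (X (Fin.last ℓ) * e k) • θ k := by
    rw [hFφ, he, Finset.smul_sum]
    simp only [smul_smul]
  have h6 := (hθ.2 F hF').unique hF h5
  have h7 := congrArg (resP K ℓ) (congrFun h6 k')
  simp only [resP_liftP, map_mul, resP_X_last, zero_mul] at h7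
  exact hk' h7

lemma isBasisOf_perm {n m : ℕ} {D : (Fin n → MvPolynomial (Fin n) K) → Prop}
    {θ : Fin m → Fin n → MvPolynomial (Fin n) K} (h : isBasisOf D θ) (σ : Equiv.Perm (Fin m)) :
    isBasisOf D (fun k => θ (σ k)) := by
  refine ⟨fun j => h.1 _, fun g hg => ?_⟩
  obtain ⟨c, hc, hu⟩ := h.2 g hg
  refine ⟨fun k => c (σ k), ?_, ?_⟩
  · change g = ∑ j, c (σ j) • θ (σ j)
    rw [Equiv.sum_comp σ (fun j => c j • θ j)]
    exact hc
  · intro c' hc'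
    have h1 := hu (fun k => c' (σ.symm k)) (by
      change g = ∑ j, c' (σ.symm j) • θ j
      rw [hc', ← Equiv.sum_comp σ (fun j => c' (σ.symm j) • θ j)]
      simp)
    funext k
    rw [← h1]
    simp

lemma finish {D D' : (Fin (ℓ + 1) → MvPolynomial (Fin (ℓ + 1)) K) → Prop}
    (m : ℕ) (hDD : ∀ f, D f → D' f)
    (hsum : ∀ c : Fin (ℓ + 1) → MvPolynomial (Fin (ℓ + 1)) K,
      ∀ θ : Fin (ℓ + 1) → Fin (ℓ + 1) → MvPolynomial (Fin (ℓ + 1)) K, (∀ k, D' (θ k)) →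
      D' (∑ k, c k • θ k))
    (hmem : ∀ f q, D' f → f (Fin.last ℓ) = X (Fin.last ℓ) ^ m * q → (D f ↔ resP K ℓ q = 0))
    (b : Fin ℓ → ℕ) (bl : ℕ)
    (θ : Fin (ℓ + 1) → Fin (ℓ + 1) → MvPolynomial (Fin (ℓ + 1)) K)
    (hθ : isBasisOf D' θ)
    (hd : ∀ k, homogOf (θ k) ((Fin.snoc b bl : Fin (ℓ + 1) → ℕ) k))
    (q : Fin (ℓ + 1) → MvPolynomial (Fin (ℓ + 1)) K)
    (hq : ∀ k, θ k (Fin.last ℓ) = X (Fin.last ℓ) ^ m * q k)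
    (c : Fin ℓ → MvPolynomial (Fin ℓ) K)
    (hL : resP K ℓ (q (Fin.last ℓ)) ≠ 0)
    (hc : ∀ k, resP K ℓ (q k.castSucc) = c k * resP K ℓ (q (Fin.last ℓ)))
    (hch : ∀ k t, (liftP K ℓ (c k) * θ (Fin.last ℓ) t).IsHomogeneous (b k)) :
    ∃ θ : Fin (ℓ + 1) → Fin (ℓ + 1) → MvPolynomial (Fin (ℓ + 1)) K,
      isBasisOf D θ ∧ ∀ k, homogOf (θ k) ((Fin.snoc b (bl + 1) : Fin (ℓ + 1) → ℕ) k) := by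
  classical
  let L := Fin.last ℓ
  let z : MvPolynomial (Fin (ℓ + 1)) K := X L
  let Θ : Fin (ℓ + 1) → Fin (ℓ + 1) → MvPolynomial (Fin (ℓ + 1)) K :=
    Fin.snoc (α := fun _ => Fin (ℓ + 1) → MvPolynomial (Fin (ℓ + 1)) K)
      (fun k => θ k.castSucc - liftP K ℓ (c k) • θ L) (z • θ L)
  have hΘc : ∀ k : Fin ℓ, Θ k.castSucc = θ k.castSucc - liftP K ℓ (c k) • θ L :=
    fun k => by simp [Θ]
  have hΘL : Θ L = z • θ L := by simp [Θ, L]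
  have hconv : ∀ a : Fin (ℓ + 1) → MvPolynomial (Fin (ℓ + 1)) K, ∑ k, a k • Θ k =
      ∑ k, (Fin.snoc (α := fun _ => MvPolynomial (Fin (ℓ + 1)) K) (fun k => a k.castSucc)
        (z * a L - ∑ k : Fin ℓ, a k.castSucc * liftP K ℓ (c k)) :
          Fin (ℓ + 1) → MvPolynomial (Fin (ℓ + 1)) K) k • θ k := by
    intro a
    rw [Fin.sum_univ_castSucc, Fin.sum_univ_castSucc]
    simp only [hΘc, Fin.snoc_castSucc, Fin.snoc_last]
    have : Θ (Fin.last ℓ) = z • θ L := hΘL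
    rw [this]
    simp only [smul_sub, Finset.sum_sub_distrib, sub_smul, Finset.sum_smul, smul_smul]
    rw [mul_comm z]
    abel
  have hD'Θ : ∀ k, D' (Θ k) := by
    intro k
    have h1 := hconv (Pi.single k 1)
    have h2 : ∑ j, (Pi.single k 1 : Fin (ℓ + 1) → MvPolynomial (Fin (ℓ + 1)) K) j • Θ j = Θ k := by
      rw [Finset.sum_eq_single k]
      · simp
      · intro j _ hj; simp [hj]
      · simp
    rw [h2] at h1
    rw [h1]
    exact hsum _ _ hθ.1
  refine ⟨Θ, ⟨?_, ?_⟩, ?_⟩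
  · intro k
    refine Fin.lastCases ?_ (fun k => ?_) k
    · rw [hmem (Θ L) (z * q L) (hD'Θ _)]
      · rw [map_mul]; simp [z, L, resP_X_last]
      · rw [hΘL, Pi.smul_apply, smul_eq_mul, hq]; simp only [z, L]; ring
    · rw [hmem (Θ k.castSucc) (q k.castSucc - liftP K ℓ (c k) * q L) (hD'Θ _)]
      · rw [map_sub, map_mul, resP_liftP, hc, sub_self]
      · rw [hΘc, Pi.sub_apply, Pi.smul_apply, smul_eq_mul, hq, hq]; ring
  · intro g hg
    obtain ⟨e, he, heu⟩ := hθ.2 g (hDD g hg)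
    have hgL : g L = z ^ m * ∑ k, e k * q k := by
      rw [he, Finset.sum_apply, Finset.mul_sum]
      refine Finset.sum_congr rfl fun k _ => ?_
      rw [Pi.smul_apply, smul_eq_mul, hq]; simp only [z, L]; ring
    have h1 := (hmem g _ (hDD g hg) hgL).1 hg
    rw [map_sum, Fin.sum_univ_castSucc] at h1
    simp only [map_mul, hc] at h1
    have h2 : (∑ k : Fin ℓ, resP K ℓ (e k.castSucc) * c k + resP K ℓ (e L)) *
        resP K ℓ (q L) = 0 := by
      rw [← h1, add_mul, Finset.sum_mul]
      simp only [mul_assoc, L]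
    have h3 := (mul_eq_zero.1 h2).resolve_right hL
    have h4 : resP K ℓ (∑ k : Fin ℓ, e k.castSucc * liftP K ℓ (c k) + e L) = 0 := by
      rw [← h3]
      simp [resP_liftP]
    obtain ⟨y, hy⟩ := resP_eq_zero.1 h4
    have hzy : z * y - ∑ k : Fin ℓ, e k.castSucc * liftP K ℓ (c k) = e L := by
      rw [show z * y = _ from hy.symm]; ring
    refine ⟨Fin.snoc (α := fun _ => MvPolynomial (Fin (ℓ + 1)) K) (fun k => e k.castSucc) y,
      ?_, ?_⟩
    · change g = ∑ k, _ • Θ k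
      rw [hconv]
      simp only [Fin.snoc_castSucc]
      have : (Fin.snoc (α := fun _ => MvPolynomial (Fin (ℓ + 1)) K)
          (fun k => e k.castSucc) y : Fin (ℓ + 1) → _) L = y := Fin.snoc_last _ _
      rw [this, hzy]
      rw [he]
      refine Finset.sum_congr rfl fun k _ => ?_
      congr 1
      refine Fin.lastCases ?_ (fun k => ?_) k <;> simp [L]
    · intro a ha
      have h5 := heu _ (ha.trans (hconv a))
      have h6 : ∀ k : Fin ℓ, a k.castSucc = e k.castSucc := by
        intro k
        rw [← h5]; simp
      have h7 : z * a L - ∑ k : Fin ℓ, a k.castSucc * liftP K ℓ (c k) = e L := by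
        rw [← h5]; simp [L]
      simp only [h6] at h7
      have h8 : z * a L = z * y := by linear_combination h7 - hzy
      have h9 := mul_left_cancel₀ (X_ne_zero _) h8
      funext k
      refine Fin.lastCases ?_ (fun k => ?_) k
      · rw [Fin.snoc_last]; exact h9
      · rw [Fin.snoc_castSucc]; exact h6 k
  · intro k
    rw [homogOf_iff]
    intro t
    have hdL := homogOf_iff.1 (hd L) t
    simp only [L, Fin.snoc_last] at hdL
    refine Fin.lastCases ?_ (fun k => ?_) k
    · rw [show Θ (Fin.last ℓ) = _ from hΘL, Fin.snoc_last, add_comm bl 1]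
      exact (isHomogeneous_X _ _).mul hdL
    · rw [hΘc, Fin.snoc_castSucc]
      have := homogOf_iff.1 (hd k.castSucc) t
      rw [Fin.snoc_castSucc] at this
      exact this.sub (hch k t)

end globalpart
/-- Addition part of the Addition–Deletion theorem for multiarrangements (ATW Thm 0.8).
The ambient space is `K^{ℓ+1}`, the distinguished hyperplane is `H₀ = ker x_{ℓ+1} = ker (α i₀)`.
The deletion `(A', ν')` lowers the multiplicity of `H₀` by one (a multiplicity-0 hyperplane
imposes no condition, so this also covers removal of `H₀`).  The restriction `(A'', ν*)` to
`H₀ ≅ K^ℓ` has hyperplanes `ker (β j)`, where `β ∘ r` records (up to nonzero scalar) the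
restrictions of the forms `α i`, `i ≠ i₀`, to `H₀`, and carries the Euler multiplicity `μ`.
If `(A', ν')` is free with exponents `{b₁,…,b_ℓ, b_{ℓ+1} - 1}` and `(A'', ν*)` is free with
exponents `{b₁,…,b_ℓ}`, then `(A, ν)` is free with exponents `{b₁,…,b_ℓ, b_{ℓ+1}}`. -/
theorem stmt11 {K : Type} [Field K] {ℓ : ℕ} {I : Type} [Fintype I] [DecidableEq I]
    (α : I → Fin (ℓ + 1) → K) (ν : I → ℕ) (i₀ : I)
    (hα₀ : α i₀ = Pi.single (Fin.last ℓ) 1) (hν₀ : 1 ≤ ν i₀)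
    (hne : ∀ i, α i ≠ 0)
    (hprop : ∀ i j, i ≠ j → ∀ c : K, α i ≠ c • α j)
    {J : Type} [Fintype J]
    (β : J → Fin ℓ → K) (hβne : ∀ j, β j ≠ 0)
    (hβprop : ∀ j j', j ≠ j' → ∀ c : K, β j ≠ c • β j')
    (r : I → J)
    (hr : ∀ i, i ≠ i₀ → ∃ c : K, c ≠ 0 ∧ (α i ∘ Fin.castSucc) = c • β (r i))
    (hrsurj : ∀ j, ∃ i, i ≠ i₀ ∧ r i = j)
    (μ : J → ℕ)
    (hμ : ∀ j : J, eulerDeg α ν i₀ {i | i = i₀ ∨ (i ≠ i₀ ∧ r i = j)} (μ j))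
    (b : Fin ℓ → ℕ) (bl : ℕ)
    (hdel : ∃ θ : Fin (ℓ + 1) → Fin (ℓ + 1) → MvPolynomial (Fin (ℓ + 1)) K,
        isBasisOf (memD α (Function.update ν i₀ (ν i₀ - 1))) θ ∧
        ∀ k, homogOf (θ k) ((Fin.snoc b bl : Fin (ℓ + 1) → ℕ) k))
    (hres : ∃ η : Fin ℓ → Fin ℓ → MvPolynomial (Fin ℓ) K,
        isBasisOf (memD β μ) η ∧ ∀ k, homogOf (η k) (b k)) :
    ∃ θ : Fin (ℓ + 1) → Fin (ℓ + 1) → MvPolynomial (Fin (ℓ + 1)) K,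
      isBasisOf (memD α ν) θ ∧ ∀ k, homogOf (θ k) ((Fin.snoc b (bl + 1) : Fin (ℓ + 1) → ℕ) k) := by
  classical
  obtain ⟨θ, hθ, hd⟩ := hdel
  obtain ⟨η, hη, hηb⟩ := hres
  -- the class of hyperplanes over each restricted hyperplane
  let cls : J → Finset I := fun j => Finset.univ.filter fun i => i ≠ i₀ ∧ r i = j
  have hlocal := fun j => local_key α ν i₀ hα₀ hν₀ hne hprop (β j) (hβne j) (cls j)
    (by simp [cls]) (fun i hi => by
      have h1 : i ≠ i₀ ∧ r i = j := by simpa [cls] using hi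
      have h2 := hr i h1.1
      rwa [h1.2] at h2) {i | i = i₀ ∨ (i ≠ i₀ ∧ r i = j)} (fun i => by simp [cls]) (μ j) (hμ j)
  have hρ : ∀ f, memD α ν f → memD β μ (fun t => resP K ℓ (f t.castSucc)) :=
    fun f hf j => (hlocal j).1 f fun i _ => hf i
  set ν' := Function.update ν i₀ (ν i₀ - 1) with hν'
  have hν'₀ : ν' i₀ = ν i₀ - 1 := by simp [hν']
  have hν'ne : ∀ i, i ≠ i₀ → ν' i = ν i := fun i hi => by simp [hν', hi]
  have hDD : ∀ f, memD α ν f → memD α ν' f := by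
    intro f hf
    apply memD_mono α _ hf
    intro i
    by_cases hi : i = i₀
    · rw [hi, hν'₀]; omega
    · rw [hν'ne i hi]
  have hmem : ∀ f q, memD α ν' f → f (Fin.last ℓ) = X (Fin.last ℓ) ^ (ν i₀ - 1) * q →
      (memD α ν f ↔ resP K ℓ q = 0) := by
    intro f q hf hq
    have hX : (X (Fin.last ℓ) : MvPolynomial (Fin (ℓ + 1)) K) ^ (ν i₀ - 1) ≠ 0 :=
      pow_ne_zero _ (X_ne_zero _)
    have h1 : lin (α i₀) ^ ν i₀ ∣ derAp f (α i₀) ↔ resP K ℓ q = 0 := by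
      rw [resP_eq_zero, hα₀, lin_last, derAp_last, hq]
      have h2 : ν i₀ = ν i₀ - 1 + 1 := by omega
      conv_lhs => rw [h2]
      rw [pow_succ, Nat.add_sub_cancel, mul_dvd_mul_iff_left hX]
    rw [← h1]
    constructor
    · exact fun h => h i₀
    · intro h i
      by_cases hi : i = i₀
      · rw [hi]; exact h
      · have := hf i
        rwa [hν'ne i hi] at this
  -- a low degree element
  obtain ⟨k₁, hk₁, hk₁D⟩ := exists_low α ν i₀ hα₀ hν₀ hne hprop (memD β μ) hρ b bl θ hθ hd η hη hηb
  have hsaito := saito_le i₀ α ν' hne hprop hθ _ hd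
  have hsd : ∑ k, (Fin.snoc b bl : Fin (ℓ + 1) → ℕ) k = ∑ k, b k + bl := by
    rw [Fin.sum_univ_castSucc]; simp
  rw [hsd] at hsaito
  let a : J → ℕ := fun j => ∑ i ∈ cls j, ν i
  have hsν : ∑ i, ν' i = ∑ j, a j + (ν i₀ - 1) := by
    rw [← Finset.sum_erase_add _ _ (Finset.mem_univ i₀), hν'₀]
    congr 1
    have h1 : ∑ i ∈ Finset.univ.erase i₀, ν' i = ∑ i ∈ Finset.univ.erase i₀, ν i :=
      Finset.sum_congr rfl fun i hi => hν'ne i (Finset.mem_erase.1 hi).1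
    rw [h1, ← Finset.sum_fiberwise _ r]
    refine Finset.sum_congr rfl fun j _ => ?_
    refine Finset.sum_congr ?_ fun _ _ => rfl
    ext i
    simp [cls]
  rw [hsν] at hsaito
  let δ := (Matrix.of η).det
  have hδ0 : δ ≠ 0 := det_basis_ne β μ hβne hη
  have hδh : δ.IsHomogeneous (∑ k, b k) := det_homog _ _ fun i j => homogOf_iff.1 (hηb i) j
  let Q := ∏ j, lin (β j) ^ a j
  have hQ0 : Q ≠ 0 := prod_lin_ne _ β a hβne
  have hQh : Q.IsHomogeneous (∑ j, a j) :=
    IsHomogeneous.prod _ _ _ fun j _ => by simpa using (lin_homog (β j)).pow (a j)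
  have hQdvd : ∀ f q, memD α ν' f → f (Fin.last ℓ) = X (Fin.last ℓ) ^ (ν i₀ - 1) * q →
      Q ∣ δ * resP K ℓ q := by
    intro f q hf hq
    apply Fintype.prod_dvd_of_isRelPrime
    · intro i j hij
      exact lin_relPrime (hβne i) (hβne j) (hβprop j i hij.symm) _ _
    · intro j
      have h1 := (hlocal j).2 f q (fun i hi => by
        have h2 : i ≠ i₀ ∧ r i = j := by simpa [cls] using hi
        have := hf i
        rwa [hν'ne i h2.1] at this) hq
      have h2 : lin (β j) ^ μ j ∣ δ := det_dvd _ (hβne j) _ fun k => hη.1 k j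
      rw [mul_comm]
      exact h1.trans (mul_dvd_mul_left _ h2)
  -- degrees of the leading coefficients
  have hdeg : ∀ f q p, f (Fin.last ℓ) = X (Fin.last ℓ) ^ (ν i₀ - 1) * q → homogOf f p →
      resP K ℓ q ≠ 0 → ν i₀ - 1 ≤ p ∧ (resP K ℓ q).IsHomogeneous (p - (ν i₀ - 1)) := by
    intro f q p hq hf h0
    have h1 := homogOf_iff.1 hf (Fin.last ℓ)
    rw [hq, mul_comm] at h1
    have h2 : q ≠ 0 := by
      rintro rfl
      exact h0 (map_zero _)
    obtain ⟨h3, h4⟩ := homog_of_mul (isHomogeneous_X_pow (Fin.last ℓ) (ν i₀ - 1)) h1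
      (mul_ne_zero h2 (pow_ne_zero _ (X_ne_zero _)))
    exact ⟨h3, resP_homog h4⟩
  have hbound : ∀ f q p, memD α ν' f → f (Fin.last ℓ) = X (Fin.last ℓ) ^ (ν i₀ - 1) * q →
      homogOf f p → resP K ℓ q ≠ 0 → ∑ j, a j + (ν i₀ - 1) ≤ ∑ k, b k + p := by
    intro f q p hfD hq hf h0
    obtain ⟨h1, h2⟩ := hdeg f q p hq hf h0
    have h3 := totalDegree_le_of_dvd_of_isDomain (hQdvd f q hfD hq) (mul_ne_zero hδ0 h0)
    rw [hQh.totalDegree hQ0, (hδh.mul h2).totalDegree (mul_ne_zero hδ0 h0)] at h3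
    omega
  -- reorder so that the low degree element is last
  let σ : Equiv.Perm (Fin (ℓ + 1)) := Equiv.swap k₁ (Fin.last ℓ)
  have hqex : ∀ k, ∃ q, θ k (Fin.last ℓ) = X (Fin.last ℓ) ^ (ν i₀ - 1) * q := by
    intro k
    have h1 := hθ.1 k i₀
    rwa [hν'₀, hα₀, lin_last, derAp_last] at h1
  choose q hq using hqex
  have hk₁0 : resP K ℓ (q k₁) ≠ 0 := fun h => hk₁D ((hmem _ _ (hθ.1 k₁) (hq k₁)).2 h)
  have hk₁b := hbound _ _ _ (hθ.1 k₁) (hq k₁) (hd k₁) hk₁0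
  have hdk₁ : (Fin.snoc b bl : Fin (ℓ + 1) → ℕ) k₁ = bl := by omega
  have hσ : ∀ k, (Fin.snoc b bl : Fin (ℓ + 1) → ℕ) (σ k) =
      (Fin.snoc b bl : Fin (ℓ + 1) → ℕ) k := by
    intro k
    by_cases h1 : k = k₁
    · subst h1
      simp only [σ, Equiv.swap_apply_left, hdk₁, Fin.snoc_last]
    by_cases h2 : k = Fin.last ℓ
    · subst h2
      simp only [σ, Equiv.swap_apply_right, hdk₁, Fin.snoc_last]
    · rw [Equiv.swap_apply_of_ne_of_ne h1 h2]
  have hσL : σ (Fin.last ℓ) = k₁ := Equiv.swap_apply_right _ _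
  have hd' : ∀ k, homogOf (θ (σ k)) ((Fin.snoc b bl : Fin (ℓ + 1) → ℕ) k) := by
    intro k
    rw [← hσ k]; exact hd _
  have hdkL : homogOf (θ k₁) bl := by
    have := hd k₁
    rwa [hdk₁] at this
  obtain ⟨hmbl, hhom⟩ := hdeg _ _ _ (hq k₁) hdkL hk₁0
  -- the leading coefficient generates
  have hQass : ∃ x : K, x ≠ 0 ∧ δ * resP K ℓ (q k₁) = C x * Q := by
    have h1 := hδh.mul hhom
    have h2 : ∑ k, b k + (bl - (ν i₀ - 1)) = ∑ j, a j := by omega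
    rw [h2] at h1
    exact dvd_homog_eq hQh h1 (mul_ne_zero hδ0 hk₁0) (hQdvd _ _ (hθ.1 k₁) (hq k₁))
  obtain ⟨x, hx, hxQ⟩ := hQass
  have hcex : ∀ k : Fin ℓ, ∃ c : MvPolynomial (Fin ℓ) K,
      resP K ℓ (q (σ k.castSucc)) = c * resP K ℓ (q k₁) ∧
      ∀ t, (liftP K ℓ c * θ k₁ t).IsHomogeneous (b k) := by
    intro k
    by_cases h0 : resP K ℓ (q (σ k.castSucc)) = 0
    · refine ⟨0, by rw [h0, zero_mul], fun t => ?_⟩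
      rw [map_zero, zero_mul]
      exact isHomogeneous_zero _ _ _
    · have h1 := hQdvd _ _ (hθ.1 (σ k.castSucc)) (hq _)
      rw [← (C_unit hx).mul_left_dvd, ← hxQ, mul_dvd_mul_iff_left hδ0] at h1
      obtain ⟨c, hc⟩ := h1
      rw [mul_comm] at hc
      refine ⟨c, hc, fun t => ?_⟩
      have h2 := hd' k.castSucc
      rw [Fin.snoc_castSucc] at h2
      obtain ⟨h3, h4⟩ := hdeg _ _ _ (hq (σ k.castSucc)) h2 h0
      have h5 := h4
      rw [hc] at h5 h0
      obtain ⟨h6, h7⟩ := homog_of_mul hhom h5 h0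
      have h8 : (liftP K ℓ c).IsHomogeneous (b k - (ν i₀ - 1) - (bl - (ν i₀ - 1))) :=
        IsHomogeneous.rename_isHomogeneous h7
      have h9 := h8.mul (homogOf_iff.1 hdkL t)
      have h10 : b k - (ν i₀ - 1) - (bl - (ν i₀ - 1)) + bl = b k := by omega
      rwa [h10] at h9
  choose c hc hch using hcex
  exact finish (D := memD α ν) (D' := memD α ν') (ν i₀ - 1) hDD
    (fun c θ h => memD_sum α ν' c θ fun k => Or.inr (h k)) hmem b bl (fun k => θ (σ k))
    (isBasisOf_perm hθ σ) hd' (fun k => q (σ k)) (fun k => hq _) c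
    (by simp only [hσL]; exact hk₁0) (by simp only [hσL]; exact hc)
    (by simp only [hσL]; exact hch)
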